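/- For every n ≥ 1 and all rationals r_1,…,r_n ∈ (0,1), the set 𝒥(π(s_n^∞), π(t_n^∞)) is countably infinite. -/

import Mathlib

noncomputable section

/-- The doubling map. -/
def Dbl (x : ℝ) : ℝ := if x ≤ 1/2 then 2*x else 2*x - 1

/-- Survivor set `𝒥(a,b)`. -/
def J (a b : ℝ) : Set ℝ := {x ∈ Set.Icc (0:ℝ) 1 | ∀ n : ℕ, Dbl^[n] x ∉ Set.Ioo a b}

/-- The shift on binary sequences. -/
def shft (x : ℕ → Bool) : ℕ → Bool := fun n => x (n+1)

/-- Binary expansion value. -/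
def piMap (w : ℕ → Bool) : ℝ := ∑' n : ℕ, (if w n then (1:ℝ) else 0) / 2 ^ (n+1)

/-- Strict lexicographic order on binary sequences. -/
def seqLt (u v : ℕ → Bool) : Prop := ∃ n, (∀ i < n, u i = v i) ∧ u n < v n

def seqLe (u v : ℕ → Bool) : Prop := seqLt u v ∨ u = v

/-- Periodic sequence `w^∞` associated with a finite word. -/
def per (w : List Bool) : ℕ → Bool := fun n => w.getD (n % w.length) false

/-- Concatenation of a finite word and an infinite sequence. -/
def cat (w : List Bool) (x : ℕ → Bool) : ℕ → Bool :=
  fun n => if n < w.length then w.getD n false else x (n - w.length)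

/-- A finite word is balanced. -/
def BalancedWord (l : List Bool) : Prop :=
  ∀ u v : List Bool, u <:+: l → v <:+: l → u.length = v.length →
    (u.count true : ℤ) - (v.count true : ℤ) ≤ 1

/-- A finite word is cyclically balanced. -/
def CycBalanced (w : List Bool) : Prop := BalancedWord (w ++ w)

def OmegaSet (r : ℚ) (b : Bool) : Set (List Bool) :=
  {w | w.length = r.den ∧ w.count true = r.num.toNat ∧ CycBalanced w ∧ w.head? = some b}

/-- `w` is the lexicographically largest cyclically balanced word of length `q`
with `p` ones beginning with 0, where `r = p/q` in lowest terms. -/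
def IsOmegaMinus (r : ℚ) (w : List Bool) : Prop :=
  w ∈ OmegaSet r false ∧ ∀ v ∈ OmegaSet r false, v = w ∨ List.Lex (· < ·) v w

/-- `w` is the lexicographically smallest cyclically balanced word of length `q`
with `p` ones beginning with 1. -/
def IsOmegaPlus (r : ℚ) (w : List Bool) : Prop :=
  w ∈ OmegaSet r true ∧ ∀ v ∈ OmegaSet r true, v = w ∨ List.Lex (· < ·) w v

open Classical in
def omegaMinus (r : ℚ) : List Bool :=
  if h : ∃ w, IsOmegaMinus r w then h.choose else []

open Classical in
def omegaPlus (r : ℚ) : List Bool :=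
  if h : ∃ w, IsOmegaPlus r w then h.choose else []

/-- The substitution `ρ_r` applied to a word. -/
def substR (r : ℚ) (w : List Bool) : List Bool :=
  (w.map (fun b => if b then omegaPlus r else omegaMinus r)).flatten

/-- `s_n = ρ_{r_1}∘⋯∘ρ_{r_n}(0)`. -/
def sWord : List ℚ → List Bool
  | [] => [false]
  | r :: rs => substR r (sWord rs)

/-- `t_n = ρ_{r_1}∘⋯∘ρ_{r_n}(1)`. -/
def tWord : List ℚ → List Bool
  | [] => [true]
  | r :: rs => substR r (tWord rs)

/-- `Δ(r_1,…,r_n) = [π(s_n^∞), π(s_n t_n^∞)]`. -/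
def DeltaI (rs : List ℚ) : Set ℝ :=
  Set.Icc (piMap (per (sWord rs))) (piMap (cat (sWord rs) (per (tWord rs))))

/-- `Δ̃(r_1,…,r_n) = [π(s_n t_n s_n^∞), π(s_n t_n^∞)]`. -/
def DeltaTilde (rs : List ℚ) : Set ℝ :=
  Set.Icc (piMap (cat (sWord rs) (cat (tWord rs) (per (sWord rs)))))
    (piMap (cat (sWord rs) (per (tWord rs))))

/-- The exceptional set `𝒮`. -/
def Scal : Set ℝ :=
  Set.Ioo (1/4 : ℝ) (1/2) \ ⋃ r ∈ {r : ℚ | 0 < r ∧ r < 1}, DeltaI [r]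

/-- `φ(a)`. -/
def phi (a : ℝ) : ℝ := sSup {b | b ∈ Set.Ioo a 1 ∧ J a b ≠ ({0, 1} : Set ℝ)}

/-- `χ(a)`. -/
def chi (a : ℝ) : ℝ := sSup {b | b ∈ Set.Ioo a 1 ∧ ¬ (J a b).Countable}

/-- `s_n` built from the first `m` entries of an infinite sequence of rationals. -/
def sWordN (r : ℕ → ℚ) (m : ℕ) : List Bool := sWord (List.ofFn fun i : Fin m => r i)

def tWordN (r : ℕ → ℚ) (m : ℕ) : List Bool := tWord (List.ofFn fun i : Fin m => r i)

/-- `𝔰(𝐫)`, the coordinatewise limit of `ρ_{r_1}⋯ρ_{r_n}(0)`. -/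
def sLim (r : ℕ → ℚ) : ℕ → Bool := fun k => (sWordN r (k+1)).getD k false

/-- `𝔱(𝐫)`. -/
def tLim (r : ℕ → ℚ) : ℕ → Bool := fun k => (tWordN r (k+1)).getD k false

/-- tail of a sequence -/
def tl (n : ℕ) (x : ℕ → Bool) : ℕ → Bool := fun k => x (k + n)

/-- lexicographic order, weak -/
def LLe (u v : ℕ → Bool) : Prop := ∀ n, (∀ i < n, u i = v i) → u n ≤ v n

theorem tl_zero (x : ℕ → Bool) : tl 0 x = x := rfl

theorem tl_tl (m n : ℕ) (x : ℕ → Bool) : tl m (tl n x) = tl (n + m) x := by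
  funext k
  simp only [tl]
  congr 1
  omega

theorem LLe.refl (u : ℕ → Bool) : LLe u u := fun _ _ => le_refl _

theorem not_LLe {u v : ℕ → Bool} (h : ¬ LLe u v) :
    ∃ n, (∀ i < n, u i = v i) ∧ u n = true ∧ v n = false := by
  unfold LLe at h
  push Not at h
  obtain ⟨n, h1, h2⟩ := h
  refine ⟨n, h1, ?_⟩
  cases hu : u n <;> cases hv : v n <;> rw [hu, hv] at h2 <;> revert h2 <;> decide

theorem LLe_of_diff {u v : ℕ → Bool} {n : ℕ} (h : ∀ i < n, u i = v i) (hu : u n = false)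
    (hv : v n = true) : LLe u v := by
  intro m hm
  rcases lt_trichotomy m n with h1 | h1 | h1
  · rw [h m h1]
  · subst h1
    rw [hu]; exact Bool.false_le _
  · have := hm n h1
    rw [hu, hv] at this
    exact absurd this (by decide)

theorem LLe_of_not {u v : ℕ → Bool} (h : ¬ LLe u v) : LLe v u := by
  obtain ⟨n, h1, h2, h3⟩ := not_LLe h
  exact LLe_of_diff (fun i hi => (h1 i hi).symm) h3 h2

theorem LLe.trans {u v w : ℕ → Bool} (h1 : LLe u v) (h2 : LLe v w) : LLe u w := by
  intro n hn
  have key : ∀ i < n, u i = v i := by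
    intro i
    induction i using Nat.strong_induction_on with
    | _ i ih =>
      intro hi
      have a : u i ≤ v i := h1 i (fun j hj => ih j hj (by omega))
      have b : v i ≤ w i := h2 i (fun j hj => by
        rw [← ih j hj (by omega)]; exact hn j (by omega))
      rw [← hn i hi] at b
      exact le_antisymm a b
  exact (h1 n key).trans (h2 n (fun i hi => by rw [← key i hi]; exact hn i hi))

theorem LLe_squeeze {a z b : ℕ → Bool} {q : ℕ} (h1 : LLe a z) (h2 : LLe z b)
    (hab : ∀ i < q, a i = b i) :
    (∀ i < q, z i = a i) ∧ LLe (tl q a) (tl q z) ∧ LLe (tl q z) (tl q b) := by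
  have key : ∀ i < q, z i = a i := by
    intro i
    induction i using Nat.strong_induction_on with
    | _ i ih =>
      intro hi
      have x : a i ≤ z i := h1 i (fun j hj => (ih j hj (by omega)).symm)
      have y : z i ≤ b i := h2 i (fun j hj => by
        rw [ih j hj (by omega)]; exact hab j (by omega))
      rw [← hab i hi] at y
      exact le_antisymm y x
  refine ⟨key, ?_, ?_⟩
  · intro n hn
    apply h1
    intro i hi
    by_cases h : i < q
    · exact (key i h).symm
    · have := hn (i - q) (by omega)
      simpa [tl, Nat.sub_add_cancel (not_lt.mp h)] using this
  · intro n hn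
    apply h2
    intro i hi
    by_cases h : i < q
    · rw [key i h, hab i h]
    · have := hn (i - q) (by omega)
      simpa [tl, Nat.sub_add_cancel (not_lt.mp h)] using this

theorem LLe_cons {u v : ℕ → Bool} (h0 : u 0 = v 0) (h : LLe (tl 1 u) (tl 1 v)) : LLe u v := by
  intro n hn
  cases n with
  | zero => rw [h0]
  | succ n => exact h n (fun i hi => hn (i + 1) (by omega))

/-! ### Substitution on sequences -/

def rho (q : ℕ) (A B : ℕ → Bool) (y : ℕ → Bool) : ℕ → Bool :=
  fun n => if y (n / q) then B n else A n

/-- the data of a renormalisation -/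
structure Ren (q : ℕ) (A B : ℕ → Bool) : Prop where
  hq : 0 < q
  pA : ∀ n, A (n + q) = A n
  pB : ∀ n, B (n + q) = B n
  A0 : A 0 = false
  B0 : B 0 = true

theorem Ren.pAm {q A B} (h : Ren q A B) (k n : ℕ) : A (n + q * k) = A n := by
  induction k with
  | zero => rfl
  | succ k ih => rw [Nat.mul_succ, ← add_assoc, h.pA, ih]

theorem Ren.pBm {q A B} (h : Ren q A B) (k n : ℕ) : B (n + q * k) = B n := by
  induction k with
  | zero => rfl
  | succ k ih => rw [Nat.mul_succ, ← add_assoc, h.pB, ih]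

theorem Ren.rho_mul {q A B} (h : Ren q A B) (y : ℕ → Bool) (k : ℕ) :
    rho q A B y (q * k) = y k := by
  have a := h.pAm k 0
  have b := h.pBm k 0
  rw [zero_add] at a b
  simp only [rho, Nat.mul_div_cancel_left k h.hq, a, b, h.A0, h.B0]
  cases y k <;> rfl

theorem Ren.tl_rho {q A B} (h : Ren q A B) (y : ℕ → Bool) (k : ℕ) :
    tl (q * k) (rho q A B y) = rho q A B (tl k y) := by
  funext n
  simp only [tl, rho, h.pAm, h.pBm, Nat.add_mul_div_left n k h.hq]
  rfl

theorem Ren.rho_le {q A B} (h : Ren q A B) {y y' : ℕ → Bool} (hy : LLe y y') :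
    LLe (rho q A B y) (rho q A B y') := by
  intro n hn
  have hk : ∀ j, q * j < n → y j = y' j := by
    intro j hj
    have := hn _ hj
    rwa [h.rho_mul, h.rho_mul] at this
  have hle : q * (n / q) ≤ n := Nat.mul_div_le n q
  have hle2 := hy (n / q) (fun j hj => hk j (lt_of_lt_of_le (Nat.mul_lt_mul_of_pos_left hj h.hq) hle))
  rcases hle.lt_or_eq with h1 | h1
  · have := hk _ h1
    simp only [rho, this, le_refl]
  · have a := h.rho_mul y (n / q)
    have b := h.rho_mul y' (n / q)
    rw [h1] at a b
    rw [a, b]; exact hle2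

theorem Ren.le_of_rho {q A B} (h : Ren q A B) {y y' : ℕ → Bool}
    (hy : LLe (rho q A B y) (rho q A B y')) : LLe y y' := by
  intro n hn
  have := hy (q * n) (fun i hi => by
    have : i / q < n := Nat.div_lt_of_lt_mul hi
    simp only [rho, hn _ this])
  rwa [h.rho_mul, h.rho_mul] at this

theorem rho_false (q A B) : rho q A B (fun _ => false) = A := by
  funext n; simp [rho]

theorem rho_true (q A B) : rho q A B (fun _ => true) = B := by
  funext n; simp [rho]

def XX (s t : ℕ → Bool) : Set (ℕ → Bool) :=
  {x | ∀ n, (x n = false → LLe (tl n x) s) ∧ (x n = true → LLe t (tl n x))}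

theorem false_LLe (x : ℕ → Bool) : LLe (fun _ => false) x := fun _ _ => Bool.false_le _
theorem LLe_true (x : ℕ → Bool) : LLe x (fun _ => true) := fun _ _ => Bool.le_true _

theorem countable_tl {C : Set (ℕ → Bool)} (hC : C.Countable) (n : ℕ) :
    {x | tl n x ∈ C}.Countable := by
  induction n with
  | zero => simpa [tl_zero] using hC
  | succ n ih =>
    have : {x | tl (n + 1) x ∈ C} ⊆
        (fun p : Bool × (ℕ → Bool) => (fun k => Nat.casesOn k p.1 p.2 : ℕ → Bool)) ''
          (Set.univ ×ˢ {x | tl n x ∈ C}) := by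
      intro x hx
      refine ⟨(x 0, tl 1 x), ⟨trivial, ?_⟩, ?_⟩
      · show tl n (tl 1 x) ∈ C
        rw [tl_tl, add_comm]; exact hx
      · funext k
        cases k <;> rfl
    exact ((Set.countable_univ.prod ih).image _).mono this

/-- entering the renormalisation interval -/
theorem Ren.enter {q A B} (h : Ren q A B) {s t x : ℕ → Bool} (hs : s 0 = false) (ht : t 0 = true)
    (hx : x ∈ XX (rho q A B s) (rho q A B t)) {n : ℕ} (h1 : LLe A (tl n x)) (h2 : LLe (tl n x) B) :
    ∃ y ∈ XX s t, tl n x = rho q A B y := by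
  have step : ∀ m, LLe A (tl m x) → LLe (tl m x) B →
      (∀ i < q, x (i + m) = if x m then B i else A i) ∧
      LLe A (tl (m + q) x) ∧ LLe (tl (m + q) x) B := by
    intro m a b
    have tA : tl q A = A := by funext k; exact h.pA k
    have tB : tl q B = B := by funext k; exact h.pB k
    cases hm : x m with
    | false =>
      have c := (hx m).1 hm
      obtain ⟨d, e, f⟩ := LLe_squeeze (q := q) a c (fun i hi => by
        simp [rho, Nat.div_eq_of_lt hi, hs])
      rw [tA, tl_tl] at e
      rw [tl_tl] at f
      have g := h.tl_rho s 1
      rw [mul_one] at g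
      rw [g] at f
      have k := h.rho_le (LLe_true (tl 1 s))
      rw [rho_true] at k
      exact ⟨by simpa [tl] using d, e, f.trans k⟩
    | true =>
      have c := (hx m).2 hm
      obtain ⟨d, e, f⟩ := LLe_squeeze (q := q) c b (fun i hi => by
        simp [rho, Nat.div_eq_of_lt hi, ht])
      rw [tB, tl_tl] at f
      rw [tl_tl] at e
      have g := h.tl_rho t 1
      rw [mul_one] at g
      rw [g] at e
      have k := h.rho_le (false_LLe (tl 1 t))
      rw [rho_false] at k
      refine ⟨fun i hi => ?_, k.trans e, f⟩
      have := d i hi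
      simpa [tl, rho, Nat.div_eq_of_lt hi, ht] using this
  have all : ∀ k, LLe A (tl (n + q * k) x) ∧ LLe (tl (n + q * k) x) B := by
    intro k
    induction k with
    | zero => exact ⟨h1, h2⟩
    | succ k ih =>
      have := (step _ ih.1 ih.2).2
      rwa [add_assoc, ← Nat.mul_succ] at this
  have hxy : tl n x = rho q A B (fun k => x (n + q * k)) := by
    funext i
    have := (step _ (all (i / q)).1 (all (i / q)).2).1 (i % q) (Nat.mod_lt _ h.hq)
    have e := Nat.mod_add_div i q
    have e1 : i % q + (n + q * (i / q)) = i + n := by omega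
    rw [e1] at this
    have a := h.pAm (i / q) (i % q)
    have b := h.pBm (i / q) (i % q)
    rw [e] at a b
    rw [← a, ← b] at this
    exact this
  refine ⟨_, ?_, hxy⟩
  intro k
  have e : tl (n + q * k) x = rho q A B (tl k (fun k => x (n + q * k))) := by
    rw [← h.tl_rho, ← hxy, tl_tl]
  constructor
  · intro hk
    have := (hx (n + q * k)).1 hk
    rw [e] at this
    exact h.le_of_rho this
  · intro hk
    have := (hx (n + q * k)).2 hk
    rw [e] at this
    exact h.le_of_rho this

theorem Ren.countable {q A B} (h : Ren q A B)
    (gap : ∀ x : ℕ → Bool, (∀ n, x n = false → ¬ LLe A (tl n x)) →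
      (∀ n, x n = true → ¬ LLe (tl n x) B) → ∀ n, x n = x 0)
    {s t : ℕ → Bool} (hs : s 0 = false) (ht : t 0 = true) (hc : (XX s t).Countable) :
    (XX (rho q A B s) (rho q A B t)).Countable := by
  have : XX (rho q A B s) (rho q A B t) ⊆
      ({fun _ => false, fun _ => true} : Set (ℕ → Bool)) ∪
        ⋃ n, {x | tl n x ∈ rho q A B '' XX s t} := by
    intro x hx
    by_cases hn : ∃ n, LLe A (tl n x) ∧ LLe (tl n x) B
    · obtain ⟨n, h1, h2⟩ := hn
      obtain ⟨y, hy, e⟩ := h.enter hs ht hx h1 h2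
      exact Or.inr (Set.mem_iUnion.2 ⟨n, y, hy, e.symm⟩)
    · left
      push Not at hn
      have := gap x (fun n h0 hA => hn n hA (LLe_of_diff (n := 0) (by simp) (by simpa [tl] using h0) h.B0))
        (fun n h0 hB => hn n (LLe_of_diff (n := 0) (by simp) h.A0 (by simpa [tl] using h0)) hB)
      cases h0 : x 0 with
      | false => left; funext n; rw [this n, h0]
      | true => right; funext n; rw [this n, h0]
  refine Set.Countable.mono this ?_
  exact (Set.toFinite _).countable.union (Set.countable_iUnion fun n => countable_tl (hc.image _) n)

/-! ### Mechanical sequences -/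

def Z (p q i : ℕ) : ℕ → Bool := fun n => decide (q ≤ (i + n * p) % q + p)

def cnt (x : ℕ → Bool) (n : ℕ) : ℕ := ∑ k ∈ Finset.range n, (if x k then 1 else 0)

theorem cnt_succ (x : ℕ → Bool) (n : ℕ) : cnt x (n + 1) = cnt x n + (if x n then 1 else 0) := by
  exact Finset.sum_range_succ _ _

theorem LLe_of_cnt {u v : ℕ → Bool} (h : ∀ n, cnt u n ≤ cnt v n) : LLe u v := by
  intro n hn
  have e : cnt u n = cnt v n := by
    unfold cnt
    apply Finset.sum_congr rfl
    intro k hk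
    rw [hn k (Finset.mem_range.1 hk)]
  have := h (n + 1)
  rw [cnt_succ, cnt_succ, e] at this
  cases hu : u n <;> cases hv : v n <;> simp_all

theorem add_div_step {p q a : ℕ} (hpq : p < q) :
    (a + p) / q = a / q + (if q ≤ a % q + p then 1 else 0) := by
  rw [Nat.add_div (by omega), Nat.div_eq_of_lt hpq, Nat.mod_eq_of_lt hpq]
  rfl

theorem cnt_Z {p q i : ℕ} (hpq : p < q) (hi : i < q) (n : ℕ) :
    cnt (Z p q i) n = (i + n * p) / q := by
  induction n with
  | zero => simp [cnt, Nat.div_eq_of_lt hi]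
  | succ n ih =>
    rw [cnt_succ, ih, Nat.succ_mul, ← add_assoc, add_div_step hpq]
    simp [Z]

theorem Z_mono {p q i j : ℕ} (hpq : p < q) (hij : i ≤ j) (hj : j < q) :
    LLe (Z p q i) (Z p q j) := by
  apply LLe_of_cnt
  intro n
  rw [cnt_Z hpq (by omega), cnt_Z hpq hj]
  exact Nat.div_le_div_right (by omega)

theorem Z_zero {p q i : ℕ} (hi : i < q) : Z p q i 0 = decide (q ≤ i + p) := by
  simp [Z, Nat.mod_eq_of_lt hi]

theorem Z_per (p q i n : ℕ) : Z p q i (n + q) = Z p q i n := by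
  simp only [Z]
  have : i + (n + q) * p = i + n * p + q * p := by ring
  rw [this, Nat.add_mul_mod_self_left]

theorem Z_perm (p q i n : ℕ) : Z p q i (n % q) = Z p q i n := by
  simp only [Z, Nat.add_mod, Nat.mul_mod, Nat.mod_mod]

theorem tl_Z (p q i : ℕ) : tl 1 (Z p q i) = Z p q ((i + p) % q) := by
  funext n
  simp only [tl, Z]
  have : i + (n + 1) * p = i + p + n * p := by ring
  rw [this, Nat.mod_add_mod]

theorem Z_ren {p q : ℕ} (hp : 0 < p) (hpq : p < q) : Ren q (Z p q (q - p - 1)) (Z p q (q - p)) where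
  hq := by omega
  pA := Z_per p q _
  pB := Z_per p q _
  A0 := by rw [Z_zero (by omega)]; simp; omega
  B0 := by rw [Z_zero (by omega)]; simp; omega

theorem Z_interval {p q : ℕ} {y : ℕ → Bool} {a b : ℕ} (hab : a < b) (h1 : LLe (Z p q a) y)
    (h2 : LLe y (Z p q b)) : ∃ i, a ≤ i ∧ i < b ∧ LLe (Z p q i) y ∧ LLe y (Z p q (i + 1)) := by
  induction b, hab using Nat.le_induction with
  | base => exact ⟨a, le_refl _, Nat.lt_succ_self a, h1, h2⟩
  | succ b hab ih =>
    by_cases h : LLe y (Z p q b)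
    · obtain ⟨i, h3, h4, h5⟩ := ih h
      exact ⟨i, h3, by omega, h5⟩
    · exact ⟨b, by omega, by omega, LLe_of_not h, h2⟩

theorem Z_no_gap {p q : ℕ} (hp : 0 < p) (hpq : p < q) (hc : Nat.Coprime p q) {x : ℕ → Bool}
    (hA : ∀ n, x n = false → ¬ LLe (Z p q (q - p - 1)) (tl n x))
    (hB : ∀ n, x n = true → ¬ LLe (tl n x) (Z p q (q - p)))
    {i n : ℕ} (hi : i + 1 < q) (h1 : LLe (Z p q i) (tl n x)) (h2 : LLe (tl n x) (Z p q (i + 1))) :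
    False := by
  have hne : ∀ {i n : ℕ}, LLe (Z p q i) (tl n x) → LLe (tl n x) (Z p q (i + 1)) →
      i ≠ q - p - 1 := by
    intro i n a b e
    cases hx : x n with
    | false => exact hA n hx (e ▸ a)
    | true =>
      apply hB n hx
      have : i + 1 = q - p := by omega
      exact this ▸ b
  have key : ∀ k, (i + k * p) % q + 1 < q ∧ LLe (Z p q ((i + k * p) % q)) (tl (n + k) x) ∧
      LLe (tl (n + k) x) (Z p q ((i + k * p) % q + 1)) := by
    intro k
    induction k with
    | zero => simpa [Nat.mod_eq_of_lt (show i < q by omega)] using ⟨hi, h1, h2⟩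
    | succ k ih =>
      obtain ⟨a, b, c⟩ := ih
      have d := hne b c
      have e : (i + (k + 1) * p) % q = ((i + k * p) % q + p) % q := by
        rw [Nat.mod_add_mod]; congr 1; ring
      rw [e]
      generalize (i + k * p) % q = j at *
      obtain ⟨_, f, g⟩ := LLe_squeeze (q := 1) b c (by
        intro l hl
        have : l = 0 := by omega
        subst this
        rw [Z_zero (by omega), Z_zero (by omega)]
        simp only [decide_eq_decide]
        omega)
      rw [tl_Z, tl_tl] at f g
      have hj : (j + p) % q + 1 < q ∧ (j + 1 + p) % q = (j + p) % q + 1 := by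
        by_cases hh : j + p < q
        · rw [Nat.mod_eq_of_lt hh, Nat.mod_eq_of_lt (by omega)]
          omega
        · rw [Nat.mod_eq_sub_mod (by omega), Nat.mod_eq_of_lt (by omega),
            Nat.mod_eq_sub_mod (by omega), Nat.mod_eq_of_lt (by omega)]
          omega
      rw [hj.2] at g
      exact ⟨hj.1, f, g⟩
  -- choose k hitting the hole
  obtain ⟨k, hk⟩ : ∃ k, (i + k * p) % q = q - p - 1 := by
    have : NeZero q := ⟨by omega⟩
    let u := ZMod.unitOfCoprime p hc
    let c : ZMod q := (((q - p - 1 : ℕ) : ZMod q) - i) * ((u⁻¹ : (ZMod q)ˣ) : ZMod q)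
    refine ⟨c.val, ?_⟩
    have h3 : ((i + c.val * p : ℕ) : ZMod q) = ((q - p - 1 : ℕ) : ZMod q) := by
      push_cast
      rw [ZMod.natCast_zmod_val]
      have : ((u⁻¹ : (ZMod q)ˣ) : ZMod q) * (p : ZMod q) = 1 := by
        rw [← ZMod.coe_unitOfCoprime p hc]
        exact u.inv_mul
      simp only [c]
      rw [mul_assoc, this]
      ring
    have h4 := (ZMod.natCast_eq_natCast_iff' _ _ _).1 h3
    rw [h4, Nat.mod_eq_of_lt (by omega)]
  obtain ⟨_, b, c⟩ := key k
  exact hne b c hk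

theorem Z_gap {p q : ℕ} (hp : 0 < p) (hpq : p < q) (hc : Nat.Coprime p q) (x : ℕ → Bool)
    (hA : ∀ n, x n = false → ¬ LLe (Z p q (q - p - 1)) (tl n x))
    (hB : ∀ n, x n = true → ¬ LLe (tl n x) (Z p q (q - p))) : ∀ n, x n = x 0 := by
  have R := Z_ren hp hpq
  have step : ∀ n, x (n + 1) = x n := by
    intro m
    cases h0 : x m <;> cases h1 : x (m + 1)
    · rfl
    · exfalso
      have a := hB _ h1
      have b := hA _ h0
      have c : ¬ LLe (tl 1 (Z p q (q - p - 1))) (tl 1 (tl m x)) := fun h =>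
        b (LLe_cons (by rw [R.A0]; simpa [tl] using h0.symm) h)
      rw [tl_Z, tl_tl] at c
      have e : (q - p - 1 + p) % q = q - 1 := by
        rw [Nat.mod_eq_of_lt (by omega)]; omega
      rw [e] at c
      have hlt : q - p < q - 1 := by
        by_contra hh
        have : q - 1 = q - p := by omega
        rw [this] at c
        exact c (LLe_of_not a)
      obtain ⟨i, h3, h4, h5, h6⟩ := Z_interval hlt (LLe_of_not a) (LLe_of_not c)
      exact Z_no_gap hp hpq hc hA hB (by omega) h5 h6
    · exfalso
      have a := hA _ h1
      have b := hB _ h0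
      have c : ¬ LLe (tl 1 (tl m x)) (tl 1 (Z p q (q - p))) := fun h =>
        b (LLe_cons (by rw [R.B0]; simpa [tl] using h0) h)
      rw [tl_Z, tl_tl] at c
      have e : (q - p + p) % q = 0 := by
        rw [Nat.sub_add_cancel hpq.le, Nat.mod_self]
      rw [e] at c
      have hlt : 0 < q - p - 1 := by
        by_contra hh
        have : q - p - 1 = 0 := by omega
        rw [this] at a
        exact c (LLe_of_not a)
      obtain ⟨i, h3, h4, h5, h6⟩ := Z_interval hlt (LLe_of_not c) (LLe_of_not a)
      exact Z_no_gap hp hpq hc hA hB (by omega) h5 h6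
    · rfl
  intro n
  induction n with
  | zero => rfl
  | succ n ih => rw [step, ih]

/-! ### Words -/

theorem count_take_eq {l : List Bool} {x : ℕ → Bool} {n : ℕ} (hn : n ≤ l.length)
    (h : ∀ k < n, l.getD k false = x k) : (l.take n).count true = cnt x n := by
  induction n with
  | zero => simp [cnt]
  | succ n ih =>
    have hl : n < l.length := by omega
    have e := h n (by omega)
    rw [List.getD_eq_getElem _ _ hl] at e
    rw [List.take_succ_eq_append_getElem hl, List.count_append,
      ih (by omega) (fun k hk => h k (by omega)), cnt_succ, e]
    cases x n <;> simp

theorem getD_double {w : List Bool} {k : ℕ} (hk : k < w.length + w.length) :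
    (w ++ w).getD k false = per w k := by
  unfold per
  by_cases h : k < w.length
  · rw [Nat.mod_eq_of_lt h, List.getD_append _ _ _ _ h]
  · rw [List.getD_append_right _ _ _ _ (by omega), Nat.mod_eq_sub_mod (by omega),
      Nat.mod_eq_of_lt (by omega)]

theorem count_take_double {w : List Bool} {n : ℕ} (hn : n ≤ w.length + w.length) :
    ((w ++ w).take n).count true = cnt (per w) n :=
  count_take_eq (by simpa using hn) (fun _ hk => getD_double (by omega))

theorem cnt_periodic {x : ℕ → Bool} {q : ℕ} (h : ∀ n, x (n + q) = x n) (m : ℕ) :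
    cnt x (m + q) = cnt x m + cnt x q := by
  induction m with
  | zero => simp [cnt]
  | succ m ih =>
    rw [show m + 1 + q = (m + q) + 1 by ring, cnt_succ, ih, h, cnt_succ]; ring

theorem cnt_sum {x : ℕ → Bool} {q : ℕ} (h : ∀ n, x (n + q) = x n) (m : ℕ) :
    ∑ i ∈ Finset.range q, cnt x (i + m) = ∑ i ∈ Finset.range q, cnt x i + m * cnt x q := by
  induction m with
  | zero => simp
  | succ m ih =>
    have h1 := Finset.sum_range_succ (fun i => cnt x (i + m)) q
    have h2 := Finset.sum_range_succ' (fun i => cnt x (i + m)) q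
    rw [h1] at h2
    have h3 : ∑ i ∈ Finset.range q, cnt x (i + 1 + m) = ∑ i ∈ Finset.range q, cnt x (i + (m + 1)) :=
      Finset.sum_congr rfl (fun i _ => by congr 1; ring)
    rw [h3, ih, add_comm q m, cnt_periodic h, zero_add] at h2
    rw [Nat.succ_mul]
    omega

theorem per_periodic (w : List Bool) (n : ℕ) : per w (n + w.length) = per w n := by
  simp [per]

theorem count_factor {w : List Bool} {i m : ℕ} (h : i + m ≤ w.length + w.length) :
    cnt (per w) (i + m) = cnt (per w) i + (((w ++ w).drop i).take m).count true := by
  rw [← count_take_double h, ← count_take_double (by omega), List.take_add, List.count_append]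

theorem cyc_diff {w : List Bool} (hw : CycBalanced w) {i j m : ℕ} (hi : i ≤ w.length)
    (hj : j ≤ w.length) (hm : m ≤ w.length) :
    cnt (per w) (i + m) + cnt (per w) j ≤ cnt (per w) (j + m) + cnt (per w) i + 1 := by
  have h1 := count_factor (w := w) (i := i) (m := m) (by omega)
  have h2 := count_factor (w := w) (i := j) (m := m) (by omega)
  have inf : ∀ i, ((w ++ w).drop i).take m <:+: w ++ w := fun i =>
    (List.take_prefix _ _).isInfix.trans (List.drop_suffix _ _).isInfix
  have := hw _ _ (inf i) (inf j) (by simp; omega)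
  omega

theorem cnt_per_length (w : List Bool) : cnt (per w) w.length = w.count true := by
  rw [← count_take_double (by omega), List.take_append_of_le_length (le_refl _), List.take_length]

/-- counts of cyclic factors are within one of the mean -/
theorem cyc_upper {w : List Bool} (hw : CycBalanced w) {i m : ℕ} (hi : i < w.length)
    (hm : m ≤ w.length) :
    w.length * cnt (per w) (i + m) + 1 ≤
      w.length * cnt (per w) i + m * w.count true + w.length := by
  have hs := cnt_sum (per_periodic w) m
  rw [cnt_per_length] at hs
  by_contra hcon
  have : ∑ j ∈ Finset.range w.length, (cnt (per w) (i + m) + cnt (per w) j) <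
      ∑ j ∈ Finset.range w.length, (cnt (per w) (j + m) + cnt (per w) i + 1) := by
    apply Finset.sum_lt_sum
    · intro j hj
      exact cyc_diff hw hi.le (Finset.mem_range.1 hj).le hm
    · exact ⟨i, Finset.mem_range.2 hi, by omega⟩
  simp only [Finset.sum_add_distrib, Finset.sum_const, Finset.card_range, smul_eq_mul] at this
  rw [hs] at this
  omega

theorem cyc_lower {w : List Bool} (hw : CycBalanced w) {i m : ℕ} (hi : i < w.length)
    (hm : m ≤ w.length) :
    w.length * cnt (per w) i + m * w.count true + 1 ≤
      w.length * cnt (per w) (i + m) + w.length := by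
  have hs := cnt_sum (per_periodic w) m
  rw [cnt_per_length] at hs
  by_contra hcon
  have : ∑ j ∈ Finset.range w.length, (cnt (per w) (j + m) + cnt (per w) i) <
      ∑ j ∈ Finset.range w.length, (cnt (per w) (i + m) + cnt (per w) j + 1) := by
    apply Finset.sum_lt_sum
    · intro j hj
      exact cyc_diff hw (Finset.mem_range.1 hj).le hi.le hm
    · exact ⟨i, Finset.mem_range.2 hi, by omega⟩
  simp only [Finset.sum_add_distrib, Finset.sum_const, Finset.card_range, smul_eq_mul] at this
  rw [hs] at this
  omega

def MW (p q i : ℕ) : List Bool := List.ofFn (fun n : Fin q => Z p q i n)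

theorem MW_length (p q i : ℕ) : (MW p q i).length = q := by simp [MW]

theorem MW_getD {p q i n : ℕ} (hn : n < q) : (MW p q i).getD n false = Z p q i n := by
  rw [List.getD_eq_getElem _ _ (by rw [MW_length]; exact hn)]
  simp [MW]

theorem per_MW {p q i : ℕ} (hq : 0 < q) : per (MW p q i) = Z p q i := by
  funext n
  unfold per
  rw [MW_length, MW_getD (Nat.mod_lt _ hq), Z_perm]

theorem MW_balanced {p q i : ℕ} (hpq : p < q) (hi : i < q) : CycBalanced (MW p q i) := by
  have key : ∀ u, u <:+: MW p q i ++ MW p q i → ∃ a,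
      (i + (a + u.length) * p) / q = (i + a * p) / q + u.count true := by
    rintro u ⟨s, t, h⟩
    have hl := congrArg List.length h
    simp only [List.length_append] at hl
    refine ⟨s.length, ?_⟩
    have := count_factor (w := MW p q i) (i := s.length) (m := u.length) (by omega)
    rw [per_MW (by omega), cnt_Z hpq hi, cnt_Z hpq hi, ← h] at this
    rw [this]
    simp
  intro u v hu hv huv
  obtain ⟨a, ha⟩ := key u hu
  obtain ⟨b, hb⟩ := key v hv
  rw [← huv] at hb
  rw [add_mul, ← add_assoc, Nat.add_div (by omega)] at ha hb
  split_ifs at ha hb <;> omega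

theorem MW_count {p q i : ℕ} (hpq : p < q) (hi : i < q) : (MW p q i).count true = p := by
  rw [← cnt_per_length, per_MW (by omega), MW_length, cnt_Z hpq hi,
    Nat.add_mul_div_left i p (by omega), Nat.div_eq_of_lt hi, zero_add]

theorem MW_mem {r : ℚ} {i : ℕ} {b : Bool} (hpq : r.num.toNat < r.den) (hi : i < r.den)
    (hb : Z r.num.toNat r.den i 0 = b) : MW r.num.toNat r.den i ∈ OmegaSet r b := by
  refine ⟨MW_length _ _ _, MW_count hpq hi, MW_balanced hpq hi, ?_⟩
  have h0 : 0 < (MW r.num.toNat r.den i).length := by rw [MW_length]; omega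
  have := MW_getD (p := r.num.toNat) (q := r.den) (i := i) (n := 0) (by omega)
  rw [List.getD_eq_getElem _ _ h0, hb] at this
  rw [List.head?_eq_getElem?, List.getElem?_eq_getElem h0, this]

theorem lex_of_count {u v : List Bool} (hl : u.length = v.length)
    (h : ∀ n ≤ u.length, (u.take n).count true ≤ (v.take n).count true) :
    u = v ∨ List.Lex (· < ·) u v := by
  induction u generalizing v with
  | nil => left; exact (List.length_eq_zero_iff.1 hl.symm).symm
  | cons a u ih =>
    cases v with
    | nil => simp at hl
    | cons b v =>
      by_cases hab : a = b
      · subst hab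
        rcases ih (v := v) (by simpa using hl) (fun n hn => by
          have := h (n + 1) (by simpa using hn)
          simpa [List.count_cons] using this) with h1 | h1
        · left; rw [h1]
        · right; exact List.Lex.cons h1
      · right
        apply List.Lex.rel
        have := h 1 (by simp)
        cases a <;> cases b <;> simp_all

theorem per_zero {w : List Bool} {b : Bool} (h : w.head? = some b) : per w 0 = b := by
  cases w with
  | nil => simp at h
  | cons a w => simpa [per] using h

theorem cnt_one (x : ℕ → Bool) : cnt x 1 = if x 0 then 1 else 0 := by
  rw [cnt_succ x 0]; simp [cnt]

theorem take_per {w : List Bool} {n : ℕ} (hn : n ≤ w.length) :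
    (w.take n).count true = cnt (per w) n := by
  rw [← count_take_double (by omega), List.take_append_of_le_length hn]

theorem isOmegaMinus_MW {r : ℚ} (hp : 0 < r.num.toNat) (hpq : r.num.toNat < r.den) :
    IsOmegaMinus r (MW r.num.toNat r.den (r.den - r.num.toNat - 1)) := by
  refine ⟨MW_mem hpq (by omega) (Z_ren hp hpq).A0, ?_⟩
  rintro v ⟨h1, h2, h3, h4⟩
  apply lex_of_count (by rw [MW_length, h1])
  intro n hn
  rw [take_per hn, take_per (by rw [MW_length]; omega), per_MW (by omega), cnt_Z hpq (by omega)]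
  cases n with
  | zero => simp [cnt]
  | succ n =>
    by_cases hq1 : v.length ≤ 1
    · omega
    have := cyc_upper h3 (i := 1) (m := n) (by omega) (by omega)
    rw [cnt_one, per_zero h4, h1, h2, add_comm 1 n] at this
    rw [Nat.le_div_iff_mul_le (by omega)]
    rw [Nat.succ_mul, mul_comm]
    simp at this
    omega

theorem isOmegaPlus_MW {r : ℚ} (hp : 0 < r.num.toNat) (hpq : r.num.toNat < r.den) :
    IsOmegaPlus r (MW r.num.toNat r.den (r.den - r.num.toNat)) := by
  refine ⟨MW_mem hpq (by omega) (Z_ren hp hpq).B0, ?_⟩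
  rintro v ⟨h1, h2, h3, h4⟩
  suffices h : MW r.num.toNat r.den (r.den - r.num.toNat) = v ∨
      List.Lex (· < ·) (MW r.num.toNat r.den (r.den - r.num.toNat)) v by
    exact h.imp_left Eq.symm
  apply lex_of_count (by rw [MW_length, h1])
  intro n hn
  rw [MW_length] at hn
  rw [take_per (by rw [MW_length]; omega), take_per (by rw [h1]; omega), per_MW (by omega),
    cnt_Z hpq (by omega)]
  cases n with
  | zero => rw [zero_mul, add_zero, Nat.div_eq_of_lt (by omega)]; exact Nat.zero_le _
  | succ n =>
    by_cases hq1 : v.length ≤ 1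
    · omega
    have := cyc_lower h3 (i := 1) (m := n) (by omega) (by omega)
    rw [cnt_one, per_zero h4, h1, h2, add_comm 1 n] at this
    apply Nat.le_of_lt_succ
    rw [Nat.div_lt_iff_lt_mul (by omega)]
    rw [Nat.succ_mul, Nat.succ_mul, mul_comm (cnt _ _)]
    simp at this
    omega

theorem omegaMinus_eq {r : ℚ} (hp : 0 < r.num.toNat) (hpq : r.num.toNat < r.den) :
    omegaMinus r = MW r.num.toNat r.den (r.den - r.num.toNat - 1) := by
  have hM := isOmegaMinus_MW hp hpq
  have hex : ∃ w, IsOmegaMinus r w := ⟨_, hM⟩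
  unfold omegaMinus
  rw [dif_pos hex]
  have hC := hex.choose_spec
  rcases hM.2 _ hC.1 with h | h
  · exact h
  · rcases hC.2 _ hM.1 with h' | h'
    · exact h'.symm
    · exact absurd h' (asymm h)

theorem omegaPlus_eq {r : ℚ} (hp : 0 < r.num.toNat) (hpq : r.num.toNat < r.den) :
    omegaPlus r = MW r.num.toNat r.den (r.den - r.num.toNat) := by
  have hM := isOmegaPlus_MW hp hpq
  have hex : ∃ w, IsOmegaPlus r w := ⟨_, hM⟩
  unfold omegaPlus
  rw [dif_pos hex]
  have hC := hex.choose_spec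
  rcases hM.2 _ hC.1 with h | h
  · exact h
  · rcases hC.2 _ hM.1 with h' | h'
    · exact h'.symm
    · exact absurd h' (asymm h)

theorem flatten_getD {q : ℕ} (hq : 0 < q) (f : Bool → List Bool) (hf : ∀ b, (f b).length = q)
    (l : List Bool) (n : ℕ) (hn : n < q * l.length) :
    (l.map f).flatten.getD n false = (f (l.getD (n / q) false)).getD (n % q) false := by
  induction l generalizing n with
  | nil => simp at hn
  | cons a l ih =>
    rw [List.map_cons, List.flatten_cons]
    by_cases h : n < q
    · rw [List.getD_append _ _ _ _ (by rw [hf]; exact h), Nat.div_eq_of_lt h, Nat.mod_eq_of_lt h]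
      rfl
    · rw [List.length_cons, Nat.mul_succ] at hn
      rw [List.getD_append_right _ _ _ _ (by rw [hf]; omega), hf, ih _ (by omega)]
      have e : n / q = (n - q) / q + 1 := by
        rw [← Nat.add_div_right _ hq]; congr 1; omega
      have e2 : n % q = (n - q) % q := Nat.mod_eq_sub_mod (by omega)
      rw [e, e2]
      rfl

theorem flatten_length {q : ℕ} (f : Bool → List Bool) (hf : ∀ b, (f b).length = q)
    (l : List Bool) : (l.map f).flatten.length = q * l.length := by
  induction l with
  | nil => simp
  | cons a l ih => simp [ih, hf, Nat.mul_succ, add_comm]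

theorem substR_length {r : ℚ} (hp : 0 < r.num.toNat) (hpq : r.num.toNat < r.den) (l : List Bool) :
    (substR r l).length = r.den * l.length := by
  apply flatten_length
  intro b
  rw [omegaMinus_eq hp hpq, omegaPlus_eq hp hpq]
  cases b <;> simp [MW_length]

theorem per_substR {r : ℚ} (hp : 0 < r.num.toNat) (hpq : r.num.toNat < r.den) (l : List Bool)
    (hl : 0 < l.length) :
    per (substR r l) = rho r.den (Z r.num.toNat r.den (r.den - r.num.toNat - 1))
      (Z r.num.toNat r.den (r.den - r.num.toNat)) (per l) := by
  have hq : 0 < r.den := r.den_pos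
  funext n
  have hL := substR_length hp hpq l
  unfold per
  rw [hL]
  unfold substR
  rw [flatten_getD hq _ _ l _ (Nat.mod_lt _ (Nat.mul_pos hq hl))]
  · rw [Nat.mod_mul_right_div_self, Nat.mod_mul_right_mod]
    rw [omegaMinus_eq hp hpq, omegaPlus_eq hp hpq]
    unfold rho
    cases hb : l.getD (n / r.den % l.length) false
    · simp only [Bool.false_eq_true, if_false]
      rw [MW_getD (Nat.mod_lt _ hq), Z_perm, if_neg (by rw [hb]; decide)]
    · simp only [if_true]
      rw [MW_getD (Nat.mod_lt _ hq), Z_perm, if_pos hb]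
  · intro b
    rw [omegaMinus_eq hp hpq, omegaPlus_eq hp hpq]
    cases b <;> simp [MW_length]

/-! ### Real numbers -/

theorem pi_summable (w : ℕ → Bool) :
    Summable (fun n : ℕ => (if w n then (1:ℝ) else 0) / 2 ^ (n+1)) := by
  have h : Summable (fun n : ℕ => (1 / 2 : ℝ) ^ n) := summable_geometric_two
  refine Summable.of_nonneg_of_le (fun n => by positivity) (fun n => ?_) h
  rw [div_pow, one_pow]
  apply div_le_div₀ (by norm_num) (by split_ifs <;> norm_num) (by positivity)
  exact pow_le_pow_right₀ (by norm_num) (by omega)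

theorem pi_rec (w : ℕ → Bool) :
    piMap w = (if w 0 then (1:ℝ) else 0) / 2 + piMap (tl 1 w) / 2 := by
  unfold piMap
  rw [(pi_summable w).tsum_eq_zero_add, ← tsum_div_const]
  congr 1
  · simp
  · apply tsum_congr
    intro n
    simp only [tl]
    rw [pow_succ _ (n + 1), div_mul_eq_div_div]
    rfl

theorem pi_nonneg (w : ℕ → Bool) : 0 ≤ piMap w := tsum_nonneg (fun n => by positivity)

theorem pi_le_one (w : ℕ → Bool) : piMap w ≤ 1 := by
  have h : HasSum (fun n : ℕ => (1 / 2 : ℝ) / 2 ^ n) 1 := by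
    simpa using hasSum_geometric_two' 1
  refine (pi_summable w).tsum_le_of_sum_le ?_ |>.trans (le_of_eq rfl) |> fun h => h
  intro s
  calc _ ≤ ∑ n ∈ s, (1 / 2 : ℝ) / 2 ^ n := by
        apply Finset.sum_le_sum
        intro n _
        rw [div_div, pow_succ, mul_comm (2:ℝ)]
        apply div_le_div_of_nonneg_right _ (by positivity)
        split_ifs <;> norm_num
    _ ≤ 1 := sum_le_hasSum s (fun n _ => by positivity) h

theorem pi_pos {w : ℕ → Bool} {n : ℕ} (h : w n = true) : 0 < piMap w := by
  induction n generalizing w with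
  | zero =>
    rw [pi_rec, if_pos h]
    have := pi_nonneg (tl 1 w)
    linarith
  | succ n ih =>
    have h1 : 0 < piMap (tl 1 w) := ih h
    rw [pi_rec]
    split_ifs <;> linarith

theorem pi_lt_one {w : ℕ → Bool} {n : ℕ} (h : w n = false) : piMap w < 1 := by
  induction n generalizing w with
  | zero =>
    rw [pi_rec, if_neg (by simp [h])]
    have := pi_le_one (tl 1 w)
    linarith
  | succ n ih =>
    have h1 : piMap (tl 1 w) < 1 := ih h
    rw [pi_rec]
    split_ifs <;> linarith

theorem pi_le_of_diff {u v : ℕ → Bool} {n : ℕ} (h : ∀ i < n, u i = v i) (hu : u n = false)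
    (hv : v n = true) : piMap u ≤ piMap v := by
  induction n generalizing u v with
  | zero =>
    rw [pi_rec u, pi_rec v, if_pos hv, if_neg (by simp [hu])]
    have := pi_le_one (tl 1 u)
    have := pi_nonneg (tl 1 v)
    linarith
  | succ n ih =>
    have : piMap (tl 1 u) ≤ piMap (tl 1 v) := ih (fun i hi => h (i + 1) (by omega)) hu hv
    rw [pi_rec u, pi_rec v, h 0 (by omega)]
    linarith

theorem pi_lt_of_diff {u v : ℕ → Bool} {n : ℕ} (h : ∀ i < n, u i = v i) (hu : u n = false)
    (hv : v n = true) (hs : piMap (tl (n + 1) u) < 1 ∨ 0 < piMap (tl (n + 1) v)) :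
    piMap u < piMap v := by
  induction n generalizing u v with
  | zero =>
    rw [pi_rec u, pi_rec v, if_pos hv, if_neg (by simp [hu])]
    have := pi_le_one (tl 1 u)
    have := pi_nonneg (tl 1 v)
    rw [zero_add] at hs
    rcases hs with hs | hs <;> linarith
  | succ n ih =>
    have : piMap (tl 1 u) < piMap (tl 1 v) := ih (fun i hi => h (i + 1) (by omega)) hu hv (by
      rw [tl_tl, tl_tl, add_comm 1]; exact hs)
    rw [pi_rec u, pi_rec v, h 0 (by omega)]
    linarith

theorem pi_mono {u v : ℕ → Bool} (h : LLe u v) : piMap u ≤ piMap v := by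
  by_cases h' : LLe v u
  · have : u = v := by
      funext n
      induction n using Nat.strong_induction_on with
      | _ n ih => exact le_antisymm (h n ih) (h' n (fun i hi => (ih i hi).symm))
    rw [this]
  · obtain ⟨n, h1, h2, h3⟩ := not_LLe h'
    exact pi_le_of_diff (fun i hi => (h1 i hi).symm) h3 h2

/-- value `b` occurs infinitely often -/
def Often (b : Bool) (x : ℕ → Bool) : Prop := ∀ N, ∃ n, x (n + N) = b

theorem Dbl_pi {w : ℕ → Bool} (h : Often true w) : Dbl (piMap w) = piMap (tl 1 w) := by
  unfold Dbl
  have h1 := pi_rec w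
  have h2 := pi_le_one (tl 1 w)
  obtain ⟨n, hn⟩ := h 1
  have h3 : 0 < piMap (tl 1 w) := pi_pos (n := n) hn
  cases hw : w 0
  · rw [hw] at h1
    simp only [Bool.false_eq_true, if_false] at h1
    rw [if_pos (by linarith)]; linarith
  · rw [hw] at h1
    simp only [if_true] at h1
    rw [if_neg (by linarith)]; linarith

theorem Dbl_mem {x : ℝ} (hx : x ∈ Set.Icc (0:ℝ) 1) : Dbl x ∈ Set.Icc (0:ℝ) 1 := by
  obtain ⟨h0, h1⟩ := hx
  unfold Dbl
  split_ifs with h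
  · constructor <;> linarith
  · constructor <;> linarith

def itin (x : ℝ) : ℕ → Bool := fun n => decide (1 / 2 < Dbl^[n] x)

theorem tl_itin (x : ℝ) (n : ℕ) : tl n (itin x) = itin (Dbl^[n] x) := by
  funext k
  simp only [tl, itin]
  rw [Function.iterate_add_apply]

theorem pi_itin_aux (n : ℕ) : ∀ x ∈ Set.Icc (0:ℝ) 1, |x - piMap (itin x)| ≤ (1 / 2) ^ n := by
  induction n with
  | zero =>
    rintro x ⟨h0, h1⟩
    have := pi_nonneg (itin x)
    have := pi_le_one (itin x)
    rw [pow_zero, abs_le]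
    constructor <;> linarith
  | succ n ih =>
    intro x hx
    have h1 := ih _ (Dbl_mem hx)
    have h2 := pi_rec (itin x)
    rw [tl_itin, Function.iterate_one] at h2
    have h3 : x - piMap (itin x) = (Dbl x - piMap (itin (Dbl x))) / 2 := by
      rw [h2]
      unfold Dbl
      by_cases h : x ≤ 1 / 2
      · rw [if_pos h, if_neg (by simpa [itin] using h)]; ring
      · rw [if_neg h, if_pos (by simpa [itin] using h)]; ring
    rw [h3, abs_div, pow_succ, abs_of_pos (by norm_num : (0:ℝ) < 2)]
    linarith

theorem pi_itin {x : ℝ} (hx : x ∈ Set.Icc (0:ℝ) 1) : piMap (itin x) = x := by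
  have h : Filter.Tendsto (fun n : ℕ => (1 / 2 : ℝ) ^ n) Filter.atTop (nhds 0) :=
    tendsto_pow_atTop_nhds_zero_of_lt_one (by norm_num) (by norm_num)
  have := ge_of_tendsto' h (fun n => pi_itin_aux n x hx)
  have := abs_nonpos_iff.1 this
  linarith

theorem iter_mem {x : ℝ} (hx : x ∈ Set.Icc (0:ℝ) 1) (n : ℕ) : Dbl^[n] x ∈ Set.Icc (0:ℝ) 1 := by
  induction n with
  | zero => exact hx
  | succ n ih => rw [Function.iterate_succ_apply']; exact Dbl_mem ih

theorem J_subset {s t : ℕ → Bool} (hs0 : s 0 = false) (ht0 : t 0 = true) (hs : Often false s)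
    (ht : Often true t) : J (piMap s) (piMap t) ⊆ piMap '' XX s t := by
  rintro x ⟨hx, hJ⟩
  refine ⟨itin x, ?_, pi_itin hx⟩
  have hs2 : piMap s ≤ 1 / 2 := by
    have := pi_rec s
    rw [hs0] at this
    have := pi_le_one (tl 1 s)
    simp_all
    linarith
  have ht2 : 1 / 2 < piMap t := by
    have h1 := pi_rec t
    rw [ht0] at h1
    obtain ⟨n, hn⟩ := ht 1
    have h3 : 0 < piMap (tl 1 t) := pi_pos (n := n) hn
    simp only [if_true] at h1
    linarith
  intro n
  have hv : piMap (tl n (itin x)) = Dbl^[n] x := by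
    rw [tl_itin, pi_itin (iter_mem hx n)]
  have hn := hJ n
  constructor
  · intro h
    by_contra hc
    obtain ⟨m, h1, h2, h3⟩ := not_LLe hc
    obtain ⟨k, hk⟩ := hs (m + 1)
    have := pi_lt_of_diff (fun i hi => (h1 i hi).symm) h3 h2 (Or.inl (pi_lt_one (n := k) hk))
    rw [hv] at this
    have h5 : Dbl^[n] x ≤ 1 / 2 := by simpa [itin] using h
    exact hn ⟨this, by linarith⟩
  · intro h
    by_contra hc
    obtain ⟨m, h1, h2, h3⟩ := not_LLe hc
    obtain ⟨k, hk⟩ := ht (m + 1)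
    have := pi_lt_of_diff (fun i hi => (h1 i hi).symm) h3 h2 (Or.inr (pi_pos (n := k) hk))
    rw [hv] at this
    have h5 : 1 / 2 < Dbl^[n] x := by simpa [itin] using h
    exact hn ⟨by linarith, this⟩

theorem Ren.Oftenrho {q A B} (h : Ren q A B) {b : Bool} {y : ℕ → Bool} (hy : Often b y) :
    Often b (rho q A B y) := by
  intro N
  obtain ⟨n, hn⟩ := hy N
  refine ⟨q * (n + N) - N, ?_⟩
  have : N ≤ q * (n + N) := by
    calc N ≤ n + N := by omega
      _ ≤ q * (n + N) := Nat.le_mul_of_pos_left _ h.hq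
  rw [Nat.sub_add_cancel this, h.rho_mul, hn]

theorem Ren.rho_zero {q A B} (h : Ren q A B) (y : ℕ → Bool) : rho q A B y 0 = y 0 := by
  simpa using h.rho_mul y 0

theorem rat_facts {r : ℚ} (h : 0 < r ∧ r < 1) :
    0 < r.num.toNat ∧ r.num.toNat < r.den ∧ Nat.Coprime r.num.toNat r.den := by
  have h1 : 0 < r.num := Rat.num_pos.2 h.1
  have h2 : r.num < r.den := Rat.num_lt_denom_iff.2 h.2
  refine ⟨by omega, by omega, ?_⟩
  have := r.reduced
  rwa [show r.num.natAbs = r.num.toNat by omega] at this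

theorem words_facts (rs : List ℚ) (hrs : ∀ r ∈ rs, 0 < r ∧ r < 1) :
    0 < (sWord rs).length ∧ 0 < (tWord rs).length ∧
    per (sWord rs) 0 = false ∧ per (tWord rs) 0 = true ∧
    Often false (per (sWord rs)) ∧ Often true (per (tWord rs)) ∧
    (XX (per (sWord rs)) (per (tWord rs))).Countable := by
  induction rs with
  | nil =>
    have e1 : per [false] = fun _ => false := by funext n; simp [per, Nat.mod_one]
    have e2 : per [true] = fun _ => true := by funext n; simp [per, Nat.mod_one]
    simp only [sWord, tWord, e1, e2]
    refine ⟨by simp, by simp, trivial, trivial, fun N => ⟨0, rfl⟩, fun N => ⟨0, rfl⟩, ?_⟩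
    refine Set.Countable.mono (s₂ := {fun _ => false, fun _ => true}) ?_ (Set.toFinite _).countable
    intro x hx
    have h1 := hx 0
    rw [tl_zero] at h1
    cases h0 : x 0 with
    | false =>
      left
      have h2 := h1.1 h0
      funext n
      induction n using Nat.strong_induction_on with
      | _ n ih => exact le_antisymm (h2 n ih) (Bool.false_le _)
    | true =>
      right
      have h2 := h1.2 h0
      funext n
      induction n using Nat.strong_induction_on with
      | _ n ih => exact le_antisymm (Bool.le_true _) (h2 n (fun i hi => (ih i hi).symm))
  | cons r rs ih =>
    obtain ⟨a, b, c, d, e, f, g⟩ := ih (fun r' hr' => hrs r' (List.mem_cons_of_mem _ hr'))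
    obtain ⟨hp, hpq, hc⟩ := rat_facts (hrs r List.mem_cons_self)
    have R := Z_ren hp hpq
    simp only [sWord, tWord]
    rw [per_substR hp hpq _ a, per_substR hp hpq _ b, substR_length hp hpq, substR_length hp hpq]
    refine ⟨Nat.mul_pos R.hq a, Nat.mul_pos R.hq b, by rw [R.rho_zero, c], by rw [R.rho_zero, d],
      R.Oftenrho e, R.Oftenrho f, R.countable (Z_gap hp hpq hc) c d g⟩

theorem Z_often {p q i : ℕ} (hp : 0 < p) (hpq : p < q) (hi : i < q) : Often true (Z p q i) := by
  intro N
  by_contra hcon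
  push Not at hcon
  have hper : ∀ n, Z p q i n = false := by
    intro n
    have h1 : Z p q i (n + N * q) = Z p q i n := by
      rw [← Z_perm p q i (n + N * q), Nat.add_mul_mod_self_right, Z_perm]
    have h2 : N ≤ N * q := Nat.le_mul_of_pos_right _ (by omega)
    have h3 := hcon (n + N * q - N)
    rw [Nat.sub_add_cancel (by omega), h1] at h3
    simpa using h3
  have := cnt_Z hpq hi q
  rw [Nat.add_mul_div_left i p (by omega), Nat.div_eq_of_lt hi] at this
  simp [cnt, hper] at this
  omega

theorem Dbl_iter_Z {p q : ℕ} (hp : 0 < p) (hpq : p < q) (n : ℕ) : ∀ i < q,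
    ∃ j < q, Dbl^[n] (piMap (Z p q i)) = piMap (Z p q j) := by
  induction n with
  | zero => exact fun i hi => ⟨i, hi, rfl⟩
  | succ n ih =>
    intro i hi
    rw [Function.iterate_succ_apply, Dbl_pi (Z_often hp hpq hi), tl_Z]
    exact ih _ (Nat.mod_lt _ (by omega))

theorem J_infinite {p q : ℕ} (hp : 0 < p) (hpq : p < q) {a b : ℝ}
    (ha : piMap (Z p q (q - p - 1)) ≤ a) (hb : b ≤ piMap (Z p q (q - p))) :
    (J a b).Infinite := by
  have R := Z_ren hp hpq
  set x := piMap (Z p q (q - p - 1)) with hx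
  have hx0 : 0 < x := by
    obtain ⟨n, hn⟩ := Z_often hp hpq (show q - p - 1 < q by omega) 0
    exact pi_pos hn
  have hx1 : x ≤ 1 / 2 := by
    have h1 := pi_rec (Z p q (q - p - 1))
    rw [R.A0] at h1
    have h2 := pi_le_one (tl 1 (Z p q (q - p - 1)))
    simp only [Bool.false_eq_true, if_false] at h1
    linarith
  have hle : ∀ k : ℕ, 0 < x / 2 ^ k ∧ x / 2 ^ k ≤ x := fun k =>
    ⟨by positivity, div_le_self hx0.le (one_le_pow₀ (by norm_num))⟩
  have hmem : ∀ k : ℕ, x / 2 ^ k ∈ J a b := by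
    intro k
    refine ⟨⟨(hle k).1.le, by linarith [(hle k).2]⟩, ?_⟩
    induction k with
    | zero =>
      intro n
      rw [pow_zero, div_one]
      obtain ⟨j, hj, e⟩ := Dbl_iter_Z hp hpq n (q - p - 1) (by omega)
      rw [hx, e]
      rintro ⟨h1, h2⟩
      by_cases h : j ≤ q - p - 1
      · have := pi_mono (Z_mono hpq h (by omega)); linarith
      · have := pi_mono (Z_mono hpq (show q - p ≤ j by omega) hj); linarith
    | succ k ih =>
      intro n
      cases n with
      | zero =>
        rintro ⟨h1, h2⟩
        rw [Function.iterate_zero_apply] at h1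
        linarith [(hle (k + 1)).2]
      | succ n =>
        have : Dbl (x / 2 ^ (k + 1)) = x / 2 ^ k := by
          unfold Dbl
          rw [if_pos (by linarith [(hle (k + 1)).2]), pow_succ]
          field_simp
        rw [Function.iterate_succ_apply, this]
        exact ih n
  refine Set.infinite_of_injective_forall_mem (f := fun k : ℕ => x / 2 ^ k) ?_ hmem
  intro k l h
  simp only at h
  rw [div_eq_div_iff (by positivity) (by positivity)] at h
  have h2 := mul_left_cancel₀ hx0.ne' h
  exact (pow_right_injective₀ (by norm_num) (by norm_num) h2).symm

theorem stmt10 (rs : List ℚ) (hne : 1 ≤ rs.length) (hrs : ∀ r ∈ rs, 0 < r ∧ r < 1) :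
    (J (piMap (per (sWord rs))) (piMap (per (tWord rs)))).Countable ∧
    (J (piMap (per (sWord rs))) (piMap (per (tWord rs)))).Infinite := by
  obtain ⟨-, -, c, d, e, f, g⟩ := words_facts rs hrs
  refine ⟨(g.image _).mono (J_subset c d e f), ?_⟩
  cases rs with
  | nil => simp at hne
  | cons r rs =>
    obtain ⟨a, b, -⟩ := words_facts rs (fun r' hr' => hrs r' (List.mem_cons_of_mem _ hr'))
    obtain ⟨hp, hpq, hc⟩ := rat_facts (hrs r List.mem_cons_self)
    have R := Z_ren hp hpq
    apply J_infinite hp hpq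
    · simp only [sWord]
      rw [per_substR hp hpq _ a]
      have := R.rho_le (false_LLe (per (sWord rs)))
      rw [rho_false] at this
      exact pi_mono this
    · simp only [tWord]
      rw [per_substR hp hpq _ b]
      have := R.rho_le (LLe_true (per (tWord rs)))
      rw [rho_true] at this
      exact pi_mono this

end
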